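/- arXiv:1301.3608 — 2 statements merged into one kernel-verified Lean document; each statement's English description precedes it below -/
import Mathlib

section
/- Let s, α be integers with s ≥ 1, α ≥ 1 and s ≡ α (mod q−1), and let l ≥ 0 be an integer such that q^l ≥ α and ℓ_q(q^l − α) + s ≥ 2. Let k ≥ 0 be an integer with k(q−1) ≥ ℓ_q(q^l − α) + s. Then the product ∏_{j=1}^{s} (t_j − θ^{q^l}) divides ∑_{d=0}^{k} S_{d,s}(−α) in K[t₁,…,t_s]. -/
/-- The monic polynomial of degree `d` over `F` with lower-order coefficients
given by `c : Fin d → F`: `X^d + ∑_{i<d} c i * X^i`.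
As `c` ranges over `Fin d → F`, this enumerates the set `A⁺(d)` of monic
polynomials of degree `d` in `A = F[θ]`. -/
noncomputable def monicOf (F : Type*) [Field F] (d : ℕ) (c : Fin d → F) : Polynomial F :=
  Polynomial.X ^ d + ∑ i : Fin d, Polynomial.C (c i) * Polynomial.X ^ (i : ℕ)

/-- `S_{d,s}(−α) = ∑_{a ∈ A⁺(d)} a(t₁) ⋯ a(t_s) · a^{−α} ∈ K[t₁,…,t_s]`, where
`K = F(θ)` and `a(t_i)` is the image of `a` under the algebra map sending `θ` to `t_i`. -/
noncomputable def SdsK (F : Type*) [Field F] [Fintype F] (d s α : ℕ) :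
    MvPolynomial (Fin s) (RatFunc F) :=
  ∑ c : Fin d → F,
    MvPolynomial.C ((algebraMap (Polynomial F) (RatFunc F) (monicOf F d c))⁻¹ ^ α) *
      ∏ i : Fin s, Polynomial.aeval (MvPolynomial.X i) (monicOf F d c)

/-- `ℓ_q(n)`: the sum of the digits of `n` in base `q`. -/
def lq (q n : ℕ) : ℕ := (Nat.digits q n).sum

open Polynomial

/-- The polynomial of degree `< d` with coefficients `c`. -/
noncomputable def polyOf (F : Type*) [Field F] (d : ℕ) (c : Fin d → F) : F[X] :=
  ∑ i : Fin d, C (c i) * X ^ (i : ℕ)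

theorem monicOf_eq (F : Type*) [Field F] (d : ℕ) (c : Fin d → F) :
    monicOf F d c = X ^ d + polyOf F d c := rfl

theorem monicOf_ne_zero (F : Type*) [Field F] (d : ℕ) (c : Fin d → F) :
    monicOf F d c ≠ 0 := by
  intro h
  have := congrArg (fun p => p.coeff d) h
  simp only [monicOf, coeff_add, finsetSum_coeff, coeff_C_mul, coeff_X_pow, coeff_zero] at this
  rw [Finset.sum_eq_zero] at this
  · simp at this
  · intro i _
    simp [i.2.ne']

theorem polyOf_snoc (F : Type*) [Field F] (d : ℕ) (c : Fin d → F) (a : F) :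
    polyOf F (d + 1) (Fin.snoc c a : Fin (d + 1) → F) = polyOf F d c + C a * X ^ d := by
  simp [polyOf, Fin.sum_univ_castSucc]

theorem polyOf_smul (F : Type*) [Field F] (d : ℕ) (c : Fin d → F) (a : F) :
    polyOf F d (a • c) = C a * polyOf F d c := by
  simp [polyOf, Finset.mul_sum, mul_assoc]

/-- For `P` homogeneous of degree divisible by `q - 1`, the sum of `P` over all polynomials of
degree `< k` is minus the sum over the monic ones. -/
theorem sum_polyOf_eq_neg_sum_monicOf (F : Type*) [Field F] [Fintype F] {R : Type*} [CommRing R]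
    [Algebra F R] (P : F[X] → R) (h0 : P 0 = 0) (hP : ∀ a : F, a ≠ 0 → ∀ p, P (C a * p) = P p)
    (k : ℕ) :
    ∑ c : Fin k → F, P (polyOf F k c) =
      -∑ d ∈ Finset.range k, ∑ c : Fin d → F, P (monicOf F d c) := by
  classical
  have hcard : (Fintype.card F : R) = 0 := by
    rw [← map_natCast (algebraMap F R), FiniteField.cast_card_eq_zero, map_zero]
  induction k with
  | zero => simp [polyOf, h0]
  | succ k ih =>
    have hunit (a : F) (ha : a ≠ 0) : ∑ c : Fin k → F, P (polyOf F k c + C a * X ^ k) =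
        ∑ c : Fin k → F, P (monicOf F k c) := by
      rw [← (MulAction.bijective (Units.mk0 a ha) : Function.Bijective
        fun c : Fin k → F => Units.mk0 a ha • c).sum_comp]
      refine Finset.sum_congr rfl fun c _ => ?_
      have : Units.mk0 a ha • c = a • c := rfl
      rw [this, polyOf_smul, ← mul_add, hP a ha, monicOf_eq, add_comm]
    rw [← (Fin.snocEquiv fun _ : Fin (k + 1) => F).sum_comp, Fintype.sum_prod_type]
    have hsnoc (a : F) (c : Fin k → F) :
        polyOf F (k + 1) ((Fin.snocEquiv fun _ : Fin (k + 1) => F) (a, c)) =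
          polyOf F k c + C a * X ^ k := polyOf_snoc F k c a
    simp only [hsnoc]
    rw [← Finset.add_sum_erase _ _ (Finset.mem_univ (0 : F)),
      Finset.sum_congr rfl fun a ha => hunit a (Finset.ne_of_mem_erase ha), Finset.sum_const,
      Finset.card_erase_of_mem (Finset.mem_univ _), Finset.card_univ, nsmul_eq_mul,
      Nat.cast_sub Fintype.card_pos, hcard, Finset.sum_range_succ]
    simp only [map_zero, zero_mul, add_zero, ih]
    push_cast
    ring

/-- A product of fewer than `(q - 1) * card ι` linear forms sums to zero over `ι → F`. -/
theorem sum_prod_linear_eq_zero {F : Type*} [Field F] [Fintype F] {R : Type*} [CommRing R]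
    [Algebra F R] {ι κ : Type*} [Fintype ι] [Fintype κ] [DecidableEq ι] [DecidableEq κ]
    (x : κ → ι → R) (h : Fintype.card κ < (Fintype.card F - 1) * Fintype.card ι) :
    ∑ c : ι → F, ∏ i, ∑ j, algebraMap F R (c j) * x i j = 0 := by
  simp only [Finset.prod_univ_sum, Fintype.piFinset_univ]
  rw [Finset.sum_comm]
  refine Finset.sum_eq_zero fun g _ => ?_
  simp only [Finset.prod_mul_distrib, ← Finset.sum_mul, ← map_prod, ← map_sum]
  have hdeg : (∏ i, MvPolynomial.X (g i) : MvPolynomial ι F).totalDegree <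
      (Fintype.card F - 1) * Fintype.card ι := by
    refine lt_of_le_of_lt (MvPolynomial.totalDegree_finsetProd _ _) ?_
    simpa using h
  have := MvPolynomial.sum_eval_eq_zero _ hdeg
  simp only [map_prod, MvPolynomial.eval_X] at this
  rw [this, map_zero, zero_mul]

theorem sum_prod_aeval_polyOf_eq_zero {F : Type*} [Field F] [Fintype F] {R : Type*} [CommRing R]
    [Algebra F R] (L : List R) (k : ℕ) (h : L.length < (Fintype.card F - 1) * k) :
    ∑ c : Fin k → F, (L.map fun x => aeval x (polyOf F k c)).prod = 0 := by
  have := sum_prod_linear_eq_zero (F := F) (ι := Fin k) (κ := Fin L.length)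
    (fun i j => L[i] ^ (j : ℕ)) (by simpa using h)
  rw [← this]
  refine Finset.sum_congr rfl fun c _ => ?_
  rw [← Fin.prod_univ_fun_getElem]
  simp [polyOf]

theorem aeval_pow_card_pow {F : Type*} [Field F] [Fintype F] {R : Type*} [CommRing R]
    [Algebra F R] (y : R) (l : ℕ) (p : F[X]) :
    aeval (y ^ Fintype.card F ^ l) p = aeval y p ^ Fintype.card F ^ l := by
  induction l generalizing y with
  | zero => simp
  | succ l ih =>
    rw [pow_succ', pow_mul, ih, ← expand_aeval, FiniteField.expand_card, map_pow, ← pow_mul]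

theorem exists_list_prod_aeval_eq_pow {F : Type*} [Field F] [Fintype F] {R : Type*} [CommRing R]
    [Algebra F R] (n : ℕ) (y : R) :
    ∃ L : List R, L.length = lq (Fintype.card F) n ∧
      ∀ p : F[X], (L.map fun x => aeval x p).prod = aeval y p ^ n := by
  induction n using Nat.strong_induction_on generalizing y with
  | _ n ih =>
    rcases Nat.eq_zero_or_pos n with rfl | hn
    · exact ⟨[], by simp [lq], by simp⟩
    have hq := Fintype.one_lt_card (α := F)
    obtain ⟨L, hL, hp⟩ := ih (n / Fintype.card F) (Nat.div_lt_self hn hq) (y ^ Fintype.card F)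
    refine ⟨List.replicate (n % Fintype.card F) y ++ L, ?_, fun p => ?_⟩
    · rw [lq, Nat.digits_def' hq hn]
      simp [hL, lq]
    · have := aeval_pow_card_pow y 1 p
      rw [pow_one] at this
      rw [List.map_append, List.prod_append, hp, this, ← pow_mul, List.map_replicate,
        List.prod_replicate, ← pow_add, Nat.mod_add_div]

/-- Vanishing of the sum over monic polynomials of degree `≤ k` of a product of evaluations. -/
theorem sum_prod_aeval_monicOf_eq_zero {F : Type*} [Field F] [Fintype F] {R : Type*} [CommRing R]
    [Algebra F R] (L : List R) (k : ℕ) (h : L.length < (Fintype.card F - 1) * k)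
    (hL : 1 ≤ L.length) (hdvd : Fintype.card F - 1 ∣ L.length) :
    ∑ d ∈ Finset.range k, ∑ c : Fin d → F, (L.map fun x => aeval x (monicOf F d c)).prod = 0 := by
  have := sum_polyOf_eq_neg_sum_monicOf F (fun p => (L.map fun x : R => aeval x p).prod) ?_ ?_ k
  · rw [sum_prod_aeval_polyOf_eq_zero L k h] at this
    exact neg_eq_zero.mp this.symm
  · simp only [map_zero, List.map_const', List.prod_replicate]
    exact zero_pow (by omega)
  · intro a ha p
    obtain ⟨m, hm⟩ := hdvd
    simp only [map_mul, List.prod_map_mul, aeval_C, List.map_const', List.prod_replicate]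
    rw [← map_pow, hm, pow_mul, FiniteField.pow_card_sub_one_eq_one a ha, one_pow, map_one, one_mul]

section Divisibility

variable {σ K : Type*} [Field K]

theorem X_sub_C_ne_zero_mvPolynomial (j : σ) (b : K) :
    (MvPolynomial.X j - MvPolynomial.C b : MvPolynomial σ K) ≠ 0 := by
  intro h
  have := congrArg (MvPolynomial.eval fun _ => b + 1) h
  simp at this

variable [DecidableEq σ]

/-- Substitution of the constant `b` for the variable `j`. -/
noncomputable def substVar (j : σ) (b : K) : MvPolynomial σ K →ₐ[K] MvPolynomial σ K :=
  MvPolynomial.aeval (Function.update MvPolynomial.X j (MvPolynomial.C b))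

theorem substVar_X_self (j : σ) (b : K) :
    substVar j b (MvPolynomial.X j) = MvPolynomial.C b := by
  simp [substVar]

theorem substVar_X_of_ne {i j : σ} (h : i ≠ j) (b : K) :
    substVar j b (MvPolynomial.X i) = MvPolynomial.X i := by
  simp [substVar, h]

theorem substVar_C (j : σ) (b a : K) :
    substVar j b (MvPolynomial.C a) = MvPolynomial.C a :=
  (substVar j b).commutes a

theorem X_sub_C_dvd_iff_substVar_eq_zero (j : σ) (b : K) (p : MvPolynomial σ K) :
    MvPolynomial.X j - MvPolynomial.C b ∣ p ↔ substVar j b p = 0 := by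
  constructor
  · rintro ⟨r, rfl⟩
    simp [substVar_X_self]
  · intro h
    set I := Ideal.span {(MvPolynomial.X j - MvPolynomial.C b : MvPolynomial σ K)} with hI
    have hcomp : (Ideal.Quotient.mkₐ K I).comp (substVar j b) = Ideal.Quotient.mkₐ K I := by
      refine MvPolynomial.algHom_ext fun i => ?_
      rcases eq_or_ne i j with rfl | hij
      · rw [AlgHom.comp_apply, substVar_X_self]
        refine ((Ideal.Quotient.mk_eq_mk_iff_sub_mem _ _).mpr ?_).symm
        exact Ideal.mem_span_singleton_self _
      · rw [AlgHom.comp_apply, substVar_X_of_ne hij]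
    have := DFunLike.congr_fun hcomp p
    rw [AlgHom.comp_apply, h, map_zero] at this
    exact Ideal.mem_span_singleton.mp (Ideal.Quotient.eq_zero_iff_mem.mp this.symm)

theorem prime_X_sub_C_mvPolynomial (j : σ) (b : K) :
    Prime (MvPolynomial.X j - MvPolynomial.C b : MvPolynomial σ K) := by
  refine ⟨X_sub_C_ne_zero_mvPolynomial j b, fun h => ?_, fun p r h => ?_⟩
  · have := h.dvd (a := 1)
    rw [X_sub_C_dvd_iff_substVar_eq_zero, map_one] at this
    exact one_ne_zero this
  · simpa only [X_sub_C_dvd_iff_substVar_eq_zero, map_mul, mul_eq_zero] using h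

theorem prod_X_sub_C_dvd [Fintype σ] (b : K) (p : MvPolynomial σ K)
    (h : ∀ j, substVar j b p = 0) :
    ∏ j, (MvPolynomial.X j - MvPolynomial.C b) ∣ p := by
  refine Finset.prod_dvd_of_isRelPrime (fun i _ j _ hij => ?_)
    fun j _ => (X_sub_C_dvd_iff_substVar_eq_zero j b p).mpr (h j)
  refine (prime_X_sub_C_mvPolynomial i b).irreducible.isRelPrime_iff_not_dvd.mpr ?_
  rw [X_sub_C_dvd_iff_substVar_eq_zero, map_sub, substVar_X_of_ne hij.symm, substVar_C]
  exact X_sub_C_ne_zero_mvPolynomial j b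

end Divisibility

theorem substVar_SdsK (F : Type*) [Field F] [Fintype F] (d s α l : ℕ)
    (hl : α ≤ Fintype.card F ^ l) (j : Fin s) :
    substVar j (algebraMap F[X] (RatFunc F) (X ^ Fintype.card F ^ l)) (SdsK F d s α) =
      ∑ c : Fin d → F,
        aeval (MvPolynomial.C (algebraMap F[X] (RatFunc F) X) : MvPolynomial (Fin s) (RatFunc F))
            (monicOf F d c) ^ (Fintype.card F ^ l - α) *
          ∏ i ∈ Finset.univ.erase j,
            aeval (MvPolynomial.X i : MvPolynomial (Fin s) (RatFunc F)) (monicOf F d c) := by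
  rw [SdsK, map_sum]
  refine Finset.sum_congr rfl fun c _ => ?_
  set p := monicOf F d c
  set b := algebraMap F[X] (RatFunc F) (X ^ Fintype.card F ^ l) with hb
  have hne : algebraMap F[X] (RatFunc F) p ≠ 0 :=
    (map_ne_zero_iff _ (IsFractionRing.injective F[X] (RatFunc F))).mpr (monicOf_ne_zero F d c)
  have hsub (y : MvPolynomial (Fin s) (RatFunc F)) :
      substVar j b (aeval y p) = aeval (substVar j b y) p :=
    (aeval_algHom_apply ((substVar j b).restrictScalars F) y p).symm
  have hC : aeval (MvPolynomial.C (algebraMap F[X] (RatFunc F) X) :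
      MvPolynomial (Fin s) (RatFunc F)) p = MvPolynomial.C (algebraMap F[X] (RatFunc F) p) := by
    have := aeval_algHom_apply ((IsScalarTower.toAlgHom F (RatFunc F)
      (MvPolynomial (Fin s) (RatFunc F))).comp (IsScalarTower.toAlgHom F F[X] (RatFunc F))) X p
    rw [aeval_X_left_apply] at this
    exact this
  have hb' : (MvPolynomial.C b : MvPolynomial (Fin s) (RatFunc F)) =
      MvPolynomial.C (algebraMap F[X] (RatFunc F) X) ^ Fintype.card F ^ l := by
    rw [hb, map_pow, MvPolynomial.C_pow]
  rw [map_mul, substVar_C, map_prod, ← Finset.mul_prod_erase _ _ (Finset.mem_univ j), hsub,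
    substVar_X_self, hb', aeval_pow_card_pow, hC, ← mul_assoc]
  congr 1
  · rw [← MvPolynomial.C_pow, ← MvPolynomial.C_pow, ← MvPolynomial.C_mul]
    congr 1
    rw [inv_pow, mul_comm, ← div_eq_mul_inv, pow_sub₀ _ hne hl, div_eq_mul_inv]
  · refine Finset.prod_congr rfl fun i hi => ?_
    rw [hsub, substVar_X_of_ne (Finset.ne_of_mem_erase hi)]

/-- If `s ≡ α (mod q−1)`, `q^l ≥ α`, `ℓ_q(q^l − α) + s ≥ 2` and `k(q−1) ≥ ℓ_q(q^l − α) + s`,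
then `∏_{j=1}^{s} (t_j − θ^{q^l})` divides `∑_{d=0}^{k} S_{d,s}(−α)` in `K[t₁,…,t_s]`. -/
theorem prod_dvd_sum_SdsK (F : Type*) [Field F] [Fintype F] (q : ℕ) (hq : Fintype.card F = q)
    (s α l k : ℕ) (hs : 1 ≤ s) (hα : 1 ≤ α) (hmod : s ≡ α [MOD q - 1])
    (hl : α ≤ q ^ l) (h2 : 2 ≤ lq q (q ^ l - α) + s)
    (hk : lq q (q ^ l - α) + s ≤ k * (q - 1)) :
    (∏ j : Fin s,
        (MvPolynomial.X j -
          MvPolynomial.C (algebraMap (Polynomial F) (RatFunc F) (Polynomial.X ^ q ^ l)))) ∣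
      ∑ d ∈ Finset.range (k + 1), SdsK F d s α := by
  subst hq
  refine prod_X_sub_C_dvd _ _ fun j => ?_
  rw [map_sum]
  simp only [substVar_SdsK F _ s α l hl j]
  obtain ⟨L, hL, hp⟩ := exists_list_prod_aeval_eq_pow (F := F) (Fintype.card F ^ l - α)
    (MvPolynomial.C (algebraMap F[X] (RatFunc F) X) : MvPolynomial (Fin s) (RatFunc F))
  set M : List (MvPolynomial (Fin s) (RatFunc F)) :=
    L ++ (Finset.univ.erase j).toList.map MvPolynomial.X with hM
  have hlen : M.length = lq (Fintype.card F) (Fintype.card F ^ l - α) + (s - 1) := by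
    simp [hM, hL]
  have hone : 1 < Fintype.card F := Fintype.one_lt_card
  have hdvd : Fintype.card F - 1 ∣ M.length := by
    have hdig : Fintype.card F ^ l - α ≡ lq (Fintype.card F) (Fintype.card F ^ l - α)
        [MOD Fintype.card F - 1] := by
      rcases Nat.lt_or_ge 1 (Fintype.card F - 1) with h | h
      · exact Nat.modEq_digits_sum _ _ (by rw [Nat.mod_eq_sub_mod (by omega),
          Nat.sub_sub_self hone.le, Nat.mod_eq_of_lt h]) _
      · rw [show Fintype.card F - 1 = 1 by omega]
        exact Nat.modEq_one
    have hpow : Fintype.card F ^ l ≡ 1 [MOD Fintype.card F - 1] := by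
      have : Fintype.card F ≡ 1 [MOD Fintype.card F - 1] :=
        ((Nat.modEq_iff_dvd' hone.le).mpr dvd_rfl).symm
      simpa using this.pow l
    have h1 : M.length + 1 ≡ 0 + 1 [MOD Fintype.card F - 1] := by
      rw [hlen, add_assoc, Nat.sub_add_cancel hs]
      calc _ ≡ (Fintype.card F ^ l - α) + α [MOD Fintype.card F - 1] := hdig.symm.add hmod
        _ = Fintype.card F ^ l := Nat.sub_add_cancel hl
        _ ≡ 0 + 1 [MOD Fintype.card F - 1] := by simpa using hpow
    exact (Nat.modEq_zero_iff_dvd).mp (Nat.ModEq.add_right_cancel' 1 h1)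
  rw [← sum_prod_aeval_monicOf_eq_zero (F := F) M (k + 1) ?_ (by omega) hdvd]
  · refine Finset.sum_congr rfl fun d _ => Finset.sum_congr rfl fun c _ => ?_
    rw [hM, List.map_append, List.prod_append, hp, List.map_map, ← Finset.prod_map_toList]
    rfl
  · rw [mul_comm, add_mul]
    omega
end

section
/- For all integers d ≥ 0, s ≥ 0 and α ≥ 1, the coefficient of the monomial t₁^d⋯t_s^d in S_{d,s}(−α) equals S_d(−α) = ∑_{a ∈ A⁺(d)} a^{−α}, which is nonzero; consequently the total degree of S_{d,s}(−α) is exactly ds. -/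
theorem monicOf_coeff_self (F : Type*) [Field F] (d : ℕ) (c : Fin d → F) :
    (monicOf F d c).coeff d = 1 := by
  rw [monicOf, Polynomial.coeff_add, Polynomial.coeff_X_pow_self, Polynomial.finsetSum_coeff,
    Finset.sum_eq_zero, add_zero]
  intro i _
  rw [Polynomial.coeff_C_mul_X_pow, if_neg i.isLt.ne']

theorem monicOf_coeff_of_lt (F : Type*) [Field F] (d : ℕ) (c : Fin d → F) (i : Fin d) :
    (monicOf F d c).coeff i = c i := by
  rw [monicOf, Polynomial.coeff_add, Polynomial.coeff_X_pow, if_neg i.isLt.ne,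
    Polynomial.finsetSum_coeff, zero_add, Finset.sum_eq_single i]
  · simp
  · intro j _ hj
    rw [Polynomial.coeff_C_mul_X_pow, if_neg fun h => hj (Fin.ext h.symm)]
  · simp

theorem monicOf_zero (F : Type*) [Field F] (d : ℕ) :
    monicOf F d 0 = Polynomial.X ^ d := by
  simp [monicOf]

theorem natDegree_monicOf_le (F : Type*) [Field F] (d : ℕ) (c : Fin d → F) :
    (monicOf F d c).natDegree ≤ d :=
  Polynomial.natDegree_add_le_of_degree_le (Polynomial.natDegree_X_pow_le d) <|
    Polynomial.natDegree_sum_le_of_forall_le _ _ fun i _ =>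
      (Polynomial.natDegree_C_mul_X_pow_le _ _).trans i.isLt.le

open WithZero in
/-- At the place `θ`, the polynomial `θ ^ d` is strictly smaller than any other monic
polynomial of degree `d`. -/
theorem valuation_idealX_monicOf_lt (F : Type*) [Field F] (d : ℕ) {c : Fin d → F} (hc : c ≠ 0) :
    (Polynomial.idealX F).valuation (RatFunc F) (algebraMap _ _ (monicOf F d 0)) <
      (Polynomial.idealX F).valuation (RatFunc F) (algebraMap _ _ (monicOf F d c)) := by
  have h0 : (Polynomial.idealX F).valuation (RatFunc F) (algebraMap _ _ (monicOf F d 0)) ≤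
      exp (-(d : ℤ)) := by
    rw [IsDedekindDomain.HeightOneSpectrum.valuation_of_algebraMap,
      IsDedekindDomain.HeightOneSpectrum.intValuation_le_pow_iff_mem, monicOf_zero,
      Polynomial.idealX_span, Ideal.span_singleton_pow]
    exact Ideal.mem_span_singleton_self _
  refine h0.trans_lt (lt_of_not_ge fun h => hc ?_)
  rw [IsDedekindDomain.HeightOneSpectrum.valuation_of_algebraMap,
    IsDedekindDomain.HeightOneSpectrum.intValuation_le_pow_iff_mem, Polynomial.idealX_span,
    Ideal.span_singleton_pow, Ideal.mem_span_singleton, Polynomial.X_pow_dvd_iff] at h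
  ext i
  rw [← monicOf_coeff_of_lt F d c i, h i i.isLt, Pi.zero_apply]

/-- The power sum `S_d(-α)` does not vanish. -/
theorem sum_inv_monicOf_pow_ne_zero (F : Type*) [Field F] [Fintype F] (d α : ℕ) (hα : 1 ≤ α) :
    (∑ c : Fin d → F, (algebraMap (Polynomial F) (RatFunc F) (monicOf F d c))⁻¹ ^ α) ≠ 0 := by
  classical
  intro h
  set v := (Polynomial.idealX F).valuation (RatFunc F)
  set f : (Fin d → F) → RatFunc F := fun c => (algebraMap _ _ (monicOf F d c))⁻¹ ^ α
  have hpos : 0 < v (algebraMap _ _ (monicOf F d 0)) := by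
    rw [Valuation.pos_iff, monicOf_zero, map_pow, RatFunc.algebraMap_X]
    exact pow_ne_zero d RatFunc.X_ne_zero
  have hlt : ∀ c ∈ Finset.univ.erase (0 : Fin d → F), v (f c) < v (f 0) := by
    intro c hc
    have hv := valuation_idealX_monicOf_lt F d (Finset.ne_of_mem_erase hc)
    simp only [f, map_pow, map_inv₀]
    exact pow_lt_pow_left₀ ((inv_lt_inv₀ (hpos.trans hv) hpos).2 hv) zero_le (by omega)
  have hne : v (f 0) ≠ 0 := by
    simpa only [f, map_pow, map_inv₀] using pow_ne_zero α (inv_ne_zero hpos.ne')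
  have hsum := v.map_sum_lt hne hlt
  rw [← Finset.add_sum_erase _ f (Finset.mem_univ 0)] at h
  rw [eq_neg_of_add_eq_zero_left h, Valuation.map_neg] at hsum
  exact hsum.false

/-- The coefficients of a product of one-variable polynomials in independent variables. -/
theorem coeff_prod_aeval_X {R S σ : Type*} [CommSemiring R] [CommSemiring S] [Algebra R S]
    [Fintype σ] (p : σ → Polynomial R) (m : σ →₀ ℕ) :
    MvPolynomial.coeff m (∏ i, Polynomial.aeval (MvPolynomial.X i : MvPolynomial σ S) (p i)) =
      ∏ i, algebraMap R S ((p i).coeff (m i)) := by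
  classical
  have hp (i : σ) : Polynomial.aeval (MvPolynomial.X i : MvPolynomial σ S) (p i) =
      ∑ k ∈ Finset.range ((p i).natDegree + 1),
        MvPolynomial.monomial (Finsupp.single i k) (algebraMap R S ((p i).coeff k)) := by
    rw [Polynomial.aeval_eq_sum_range]
    refine Finset.sum_congr rfl fun k _ => ?_
    rw [MvPolynomial.X_pow_eq_monomial, MvPolynomial.smul_monomial, Algebra.algebraMap_eq_smul_one]
  have hsingle (x : σ → ℕ) : ∑ i, Finsupp.single i (x i) = m ↔ x = m := by
    rw [← Finsupp.equivFunOnFinite_symm_eq_sum, Equiv.symm_apply_eq]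
    rfl
  simp_rw [hp, Finset.prod_univ_sum, MvPolynomial.coeff_sum, ← MvPolynomial.monomial_sum_prod,
    MvPolynomial.coeff_monomial, hsingle]
  rw [Finset.sum_ite_eq']
  split_ifs with h
  · rfl
  · simp only [Fintype.mem_piFinset, Finset.mem_range, not_forall, not_lt] at h
    obtain ⟨i, hi⟩ := h
    refine (Finset.prod_eq_zero (Finset.mem_univ i) ?_).symm
    rw [Polynomial.coeff_eq_zero_of_natDegree_lt hi, map_zero]

theorem totalDegree_aeval_X_le {R S σ : Type*} [CommSemiring R] [CommSemiring S] [Nontrivial S]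
    [Algebra R S] (p : Polynomial R) (i : σ) :
    (Polynomial.aeval (MvPolynomial.X i : MvPolynomial σ S) p).totalDegree ≤ p.natDegree := by
  rw [Polynomial.aeval_eq_sum_range]
  refine MvPolynomial.totalDegree_finsetSum_le fun k hk => ?_
  refine (MvPolynomial.totalDegree_smul_le _ _).trans ?_
  rw [MvPolynomial.totalDegree_X_pow]
  exact Nat.lt_succ_iff.1 (Finset.mem_range.1 hk)

theorem coeff_SdsK (F : Type*) [Field F] [Fintype F] (d s α : ℕ) :
    MvPolynomial.coeff (Finsupp.equivFunOnFinite.symm fun _ : Fin s => d) (SdsK F d s α) =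
      ∑ c : Fin d → F, (algebraMap (Polynomial F) (RatFunc F) (monicOf F d c))⁻¹ ^ α := by
  rw [SdsK, MvPolynomial.coeff_sum]
  refine Finset.sum_congr rfl fun c _ => ?_
  rw [MvPolynomial.coeff_C_mul, coeff_prod_aeval_X]
  simp [monicOf_coeff_self]

theorem totalDegree_SdsK_le (F : Type*) [Field F] [Fintype F] (d s α : ℕ) :
    (SdsK F d s α).totalDegree ≤ d * s := by
  refine MvPolynomial.totalDegree_finsetSum_le fun c _ => ?_
  refine (MvPolynomial.totalDegree_mul _ _).trans ?_
  rw [MvPolynomial.totalDegree_C, zero_add]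
  refine (MvPolynomial.totalDegree_finsetProd _ _).trans ?_
  refine (Finset.sum_le_card_nsmul _ _ d fun i _ =>
    (totalDegree_aeval_X_le _ i).trans (natDegree_monicOf_le F d c)).trans_eq ?_
  simp [mul_comm]

/-- The coefficient of `t₁^d ⋯ t_s^d` in `S_{d,s}(−α)` is
`S_d(−α) = ∑_{a ∈ A⁺(d)} a^{−α}`, which is nonzero; consequently the total
degree of `S_{d,s}(−α)` is exactly `ds`. -/
theorem coeff_and_totalDegree_SdsK (F : Type*) [Field F] [Fintype F] (d s α : ℕ)
    (hα : 1 ≤ α) :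
    MvPolynomial.coeff (Finsupp.equivFunOnFinite.symm fun _ : Fin s => d) (SdsK F d s α) =
        (∑ c : Fin d → F, (algebraMap (Polynomial F) (RatFunc F) (monicOf F d c))⁻¹ ^ α) ∧
      MvPolynomial.coeff (Finsupp.equivFunOnFinite.symm fun _ : Fin s => d)
          (SdsK F d s α) ≠ 0 ∧
      (SdsK F d s α).totalDegree = d * s := by
  have hne := sum_inv_monicOf_pow_ne_zero F d α hα
  rw [← coeff_SdsK F d s α] at hne
  refine ⟨coeff_SdsK F d s α, hne, (totalDegree_SdsK_le F d s α).antisymm ?_⟩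
  have hle := MvPolynomial.le_totalDegree (MvPolynomial.mem_support_iff.2 hne)
  rw [Finsupp.sum_fintype _ _ fun _ => rfl] at hle
  simpa [mul_comm] using hle
end
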